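/- Let W_Θ ⊆ W be a parabolic subgroup. The natural map ι : S_W → S_{W_Θ} induced by the identity on S is surjective, and its kernel equals the ideal (S_W^{W_Θ})⁺ · S_W generated by the positive-degree W_Θ-invariant elements of S_W. Moreover, S_W is a free module of rank |W_Θ| over S_W^{W_Θ}. -/

import Mathlib

open scoped RealInnerProductSpace

/-- The reflection in the vector `γ`: `x ↦ x − (2⟨x,γ⟩/⟨γ,γ⟩)γ`. -/
noncomputable def reflectRoot {n : ℕ} (γ x : EuclideanSpace ℝ (Fin n)) :
    EuclideanSpace ℝ (Fin n) :=
  x - (2 * ⟪x, γ⟫ / ⟪γ, γ⟫) • γ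

/-- The coroot functional `γ̌(x) = 2⟨x,γ⟩/⟨γ,γ⟩`. -/
noncomputable def corootPair {n : ℕ} (γ x : EuclideanSpace ℝ (Fin n)) : ℝ :=
  2 * ⟪x, γ⟫ / ⟪γ, γ⟫

/-- A (reduced) root system in Euclidean space `ℝ^n` together with a choice of simple
system `Δ` and the corresponding positive system `pos`. -/
structure RootData (n : ℕ) where
  /-- The set of roots. -/
  Φ : Set (EuclideanSpace ℝ (Fin n))
  /-- The simple system. -/
  Δ : Set (EuclideanSpace ℝ (Fin n))
  /-- The positive system determined by `Δ`. -/
  pos : Set (EuclideanSpace ℝ (Fin n))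
  finite : Φ.Finite
  nonzero : ∀ γ ∈ Φ, γ ≠ 0
  reduced : ∀ γ ∈ Φ, ∀ t : ℝ, t • γ ∈ Φ → t = 1 ∨ t = -1
  reflect_mem : ∀ γ ∈ Φ, ∀ β ∈ Φ, reflectRoot γ β ∈ Φ
  Δ_sub : Δ ⊆ pos
  pos_sub : pos ⊆ Φ
  simple_indep : LinearIndependent ℝ (fun a : Δ => (a : EuclideanSpace ℝ (Fin n)))
  pos_combo : ∀ γ ∈ pos, ∃ c : EuclideanSpace ℝ (Fin n) →₀ ℝ,
    ↑c.support ⊆ Δ ∧ (∀ a, 0 ≤ c a) ∧ γ = c.sum fun a t => t • a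
  pos_partition : ∀ γ ∈ Φ, (γ ∈ pos ∧ -γ ∉ pos) ∨ (γ ∉ pos ∧ -γ ∈ pos)

/-- A vector in ℝ^n regarded as a linear form, i.e. a degree-one polynomial. -/
noncomputable def toPoly {n : ℕ} (v : EuclideanSpace ℝ (Fin n)) :
    MvPolynomial (Fin n) ℝ :=
  ∑ i, MvPolynomial.C (v i) * MvPolynomial.X i

/-- The action of a linear automorphism of ℝ^n on the polynomial ring S = Sym(ℝ^n),
determined by its action on the degree-one part. -/
noncomputable def polyAct {n : ℕ}
    (g : EuclideanSpace ℝ (Fin n) ≃ₗ[ℝ] EuclideanSpace ℝ (Fin n)) :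
    MvPolynomial (Fin n) ℝ →ₐ[ℝ] MvPolynomial (Fin n) ℝ :=
  MvPolynomial.aeval fun i => toPoly (g (EuclideanSpace.single i 1))

/-- The action of the reflection s_γ on the polynomial ring S = Sym(ℝ^n). -/
noncomputable def reflPolyAct {n : ℕ} (γ : EuclideanSpace ℝ (Fin n)) :
    MvPolynomial (Fin n) ℝ →ₐ[ℝ] MvPolynomial (Fin n) ℝ :=
  MvPolynomial.aeval fun i => toPoly (reflectRoot γ (EuclideanSpace.single i 1))

/-- The reflection group `W` generated by the reflections in the roots. -/
noncomputable def RootData.W {n : ℕ} (R : RootData n) :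
    Subgroup (EuclideanSpace ℝ (Fin n) ≃ₗ[ℝ] EuclideanSpace ℝ (Fin n)) :=
  Subgroup.closure {σ | ∃ γ ∈ R.Φ, ∀ x, σ x = reflectRoot γ x}

/-- The parabolic subgroup generated by reflections in the simple roots of `Θ`. -/
noncomputable def parabolic {n : ℕ} (Θ : Set (EuclideanSpace ℝ (Fin n))) :
    Subgroup (EuclideanSpace ℝ (Fin n) ≃ₗ[ℝ] EuclideanSpace ℝ (Fin n)) :=
  Subgroup.closure {σ | ∃ γ ∈ Θ, ∀ x, σ x = reflectRoot γ x}

/-- The set of polynomials invariant under the group `G`. -/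
def invSet {n : ℕ}
    (G : Subgroup (EuclideanSpace ℝ (Fin n) ≃ₗ[ℝ] EuclideanSpace ℝ (Fin n))) :
    Set (MvPolynomial (Fin n) ℝ) :=
  {f | ∀ w ∈ G, polyAct w f = f}

/-- The ideal generated by the positive-degree `G`-invariant polynomials. -/
noncomputable def invIdeal {n : ℕ}
    (G : Subgroup (EuclideanSpace ℝ (Fin n) ≃ₗ[ℝ] EuclideanSpace ℝ (Fin n))) :
    Ideal (MvPolynomial (Fin n) ℝ) :=
  Ideal.span {f | f ∈ invSet G ∧ MvPolynomial.constantCoeff f = 0}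

/-- `x` in the coinvariant ring `S/I` is `G`-invariant (for the induced action):
every lift of `x` is sent to a lift of `x` by every element of `G`. -/
def relInv {n : ℕ}
    (G : Subgroup (EuclideanSpace ℝ (Fin n) ≃ₗ[ℝ] EuclideanSpace ℝ (Fin n)))
    (I : Ideal (MvPolynomial (Fin n) ℝ)) (x : MvPolynomial (Fin n) ℝ ⧸ I) : Prop :=
  ∀ w ∈ G, ∀ F : MvPolynomial (Fin n) ℝ,
    Ideal.Quotient.mk I F = x → Ideal.Quotient.mk I (polyAct w F) = x


theorem toPoly_add' {n : ℕ} (v w : EuclideanSpace ℝ (Fin n)) :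
    toPoly (v + w) = toPoly v + toPoly w := by
  simp [toPoly, add_mul, Finset.sum_add_distrib]

theorem toPoly_smul' {n : ℕ} (c : ℝ) (v : EuclideanSpace ℝ (Fin n)) :
    toPoly (c • v) = MvPolynomial.C c * toPoly v := by
  simp [toPoly, Finset.mul_sum, mul_assoc]

/-- `toPoly` as a linear map. -/
noncomputable def toPolyL (n : ℕ) :
    EuclideanSpace ℝ (Fin n) →ₗ[ℝ] MvPolynomial (Fin n) ℝ where
  toFun := toPoly
  map_add' := toPoly_add'
  map_smul' c v := by simp [toPoly_smul', MvPolynomial.smul_eq_C_mul]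

theorem toPoly_single {n : ℕ} (i : Fin n) :
    toPoly (EuclideanSpace.single i (1 : ℝ)) = MvPolynomial.X i := by
  classical
  simp [toPoly]

theorem toPoly_coeff {n : ℕ} (v : EuclideanSpace ℝ (Fin n)) (i : Fin n) :
    MvPolynomial.coeff (Finsupp.single i 1) (toPoly v) = v i := by
  classical
  simp [toPoly, MvPolynomial.coeff_sum, MvPolynomial.coeff_C_mul, MvPolynomial.coeff_X,
    Finsupp.single_left_inj]

theorem toPoly_injective {n : ℕ} : Function.Injective (toPoly (n := n)) := by
  intro v w h
  ext i
  rw [← toPoly_coeff, h, toPoly_coeff]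

theorem toPoly_hom {n : ℕ} (v : EuclideanSpace ℝ (Fin n)) : (toPoly v).IsHomogeneous 1 := by
  apply MvPolynomial.IsHomogeneous.sum
  intro i _
  simpa using (MvPolynomial.isHomogeneous_C (Fin n) (v i)).mul (MvPolynomial.isHomogeneous_X ℝ i)

theorem polyAct_toPoly {n : ℕ} (g : EuclideanSpace ℝ (Fin n) ≃ₗ[ℝ] EuclideanSpace ℝ (Fin n))
    (v : EuclideanSpace ℝ (Fin n)) : polyAct g (toPoly v) = toPoly (g v) := by
  have h : (polyAct g).toLinearMap ∘ₗ toPolyL n = toPolyL n ∘ₗ g.toLinearMap := by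
    apply (EuclideanSpace.basisFun (Fin n) ℝ).toBasis.ext
    intro i
    simp only [OrthonormalBasis.coe_toBasis, EuclideanSpace.basisFun_apply, LinearMap.comp_apply,
      AlgHom.toLinearMap_apply, LinearEquiv.coe_coe]
    change polyAct g (toPoly _) = toPoly _
    rw [toPoly_single]
    simp [polyAct]
  exact LinearMap.congr_fun h v

theorem polyAct_X {n : ℕ} (g : EuclideanSpace ℝ (Fin n) ≃ₗ[ℝ] EuclideanSpace ℝ (Fin n))
    (i : Fin n) : polyAct g (MvPolynomial.X i) = toPoly (g (EuclideanSpace.single i 1)) := by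
  simp [polyAct]

theorem polyAct_one' {n : ℕ} (f : MvPolynomial (Fin n) ℝ) : polyAct 1 f = f := by
  have : polyAct (n := n) 1 = AlgHom.id ℝ _ := by
    apply MvPolynomial.algHom_ext
    intro i
    rw [polyAct_X]
    exact toPoly_single i
  rw [this]; rfl

theorem polyAct_mul' {n : ℕ} (g h : EuclideanSpace ℝ (Fin n) ≃ₗ[ℝ] EuclideanSpace ℝ (Fin n))
    (f : MvPolynomial (Fin n) ℝ) : polyAct (g * h) f = polyAct g (polyAct h f) := by
  have : polyAct (g * h) = (polyAct g).comp (polyAct h) := by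
    apply MvPolynomial.algHom_ext
    intro i
    rw [polyAct_X, AlgHom.comp_apply, polyAct_X, polyAct_toPoly]
    rfl
  rw [this]; rfl

theorem polyAct_hom {n : ℕ} (g : EuclideanSpace ℝ (Fin n) ≃ₗ[ℝ] EuclideanSpace ℝ (Fin n))
    {f : MvPolynomial (Fin n) ℝ} {d : ℕ} (hf : f.IsHomogeneous d) :
    (polyAct g f).IsHomogeneous d := by
  have h := hf.aeval (fun i => toPoly (g (EuclideanSpace.single i 1))) (fun i => toPoly_hom _)
  rw [one_mul] at h
  exact h

theorem polyAct_homComp {n : ℕ} (g : EuclideanSpace ℝ (Fin n) ≃ₗ[ℝ] EuclideanSpace ℝ (Fin n))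
    (f : MvPolynomial (Fin n) ℝ) (d : ℕ) :
    polyAct g (MvPolynomial.homogeneousComponent d f) =
      MvPolynomial.homogeneousComponent d (polyAct g f) := by
  conv_rhs => rw [← MvPolynomial.sum_homogeneousComponent f]
  rw [map_sum, map_sum]
  simp_rw [fun i => MvPolynomial.homogeneousComponent_of_mem (m := d)
    (polyAct_hom g (MvPolynomial.homogeneousComponent_isHomogeneous i f))]
  rw [Finset.sum_ite_eq]
  split_ifs with h
  · rfl
  · rw [MvPolynomial.homogeneousComponent_eq_zero, map_zero]
    simpa using h

theorem polyAct_totalDegree {n : ℕ}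
    (g : EuclideanSpace ℝ (Fin n) ≃ₗ[ℝ] EuclideanSpace ℝ (Fin n))
    (f : MvPolynomial (Fin n) ℝ) : (polyAct g f).totalDegree ≤ f.totalDegree := by
  conv_lhs => rw [← MvPolynomial.sum_homogeneousComponent f]
  rw [map_sum]
  refine (MvPolynomial.totalDegree_finsetSum _ _).trans (Finset.sup_le fun i hi => ?_)
  refine (polyAct_hom g (MvPolynomial.homogeneousComponent_isHomogeneous i f)).totalDegree_le.trans ?_
  simp at hi
  omega

theorem polyAct_constantCoeff {n : ℕ}
    (g : EuclideanSpace ℝ (Fin n) ≃ₗ[ℝ] EuclideanSpace ℝ (Fin n))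
    (f : MvPolynomial (Fin n) ℝ) :
    MvPolynomial.constantCoeff (polyAct g f) = MvPolynomial.constantCoeff f := by
  have h := polyAct_homComp g f 0
  rw [MvPolynomial.homogeneousComponent_zero, MvPolynomial.homogeneousComponent_zero,
    ← MvPolynomial.algebraMap_eq, AlgHom.commutes, MvPolynomial.algebraMap_eq] at h
  exact (MvPolynomial.C_injective _ _ h).symm

/-- The invariant subalgebra. -/
def invSub {n : ℕ} (G : Subgroup (EuclideanSpace ℝ (Fin n) ≃ₗ[ℝ] EuclideanSpace ℝ (Fin n))) :
    Subalgebra ℝ (MvPolynomial (Fin n) ℝ) where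
  carrier := invSet G
  mul_mem' ha hb w hw := by rw [map_mul, ha w hw, hb w hw]
  add_mem' ha hb w hw := by rw [map_add, ha w hw, hb w hw]
  algebraMap_mem' r w _ := AlgHom.commutes _ r

/-- The action on polynomials. -/
@[reducible]
noncomputable def polyMSA {n : ℕ}
    (G : Subgroup (EuclideanSpace ℝ (Fin n) ≃ₗ[ℝ] EuclideanSpace ℝ (Fin n))) :
    MulSemiringAction G (MvPolynomial (Fin n) ℝ) where
  smul g f := polyAct g.1 f
  one_smul f := polyAct_one' f
  mul_smul g h f := polyAct_mul' g.1 h.1 f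
  smul_zero _ := map_zero _
  smul_add _ := map_add _
  smul_one _ := map_one _
  smul_mul _ := map_mul _

theorem finrank_invSub {n : ℕ}
    (G : Subgroup (EuclideanSpace ℝ (Fin n) ≃ₗ[ℝ] EuclideanSpace ℝ (Fin n))) [Finite G] :
    Nat.card G = Module.finrank (invSub G) (MvPolynomial (Fin n) ℝ) := by
  let := polyMSA G
  have hs : ∀ (g : G) (f : MvPolynomial (Fin n) ℝ), g • f = polyAct g.1 f := fun _ _ => rfl
  have : IsGaloisGroup G (invSub G) (MvPolynomial (Fin n) ℝ) :=
    { faithful := ⟨by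
        intro g h hgh
        apply Subtype.ext
        apply LinearEquiv.ext
        intro v
        apply toPoly_injective
        rw [← polyAct_toPoly, ← polyAct_toPoly]
        exact hgh _⟩
      commutes := ⟨by
        intro g a b
        rw [hs, hs, Algebra.smul_def, Algebra.smul_def, map_mul]
        congr 1
        exact a.2 g.1 g.2⟩
      isInvariant := ⟨fun b hb => ⟨⟨b, fun w hw => hb ⟨w, hw⟩⟩, rfl⟩⟩ }
  exact IsGaloisGroup.card_eq_finrank' G (invSub G) (MvPolynomial (Fin n) ℝ)

theorem polyAct_invIdeal {n : ℕ}
    {G H : Subgroup (EuclideanSpace ℝ (Fin n) ≃ₗ[ℝ] EuclideanSpace ℝ (Fin n))} (hHG : H ≤ G)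
    {g : EuclideanSpace ℝ (Fin n) ≃ₗ[ℝ] EuclideanSpace ℝ (Fin n)} (hg : g ∈ H)
    {f : MvPolynomial (Fin n) ℝ} (hf : f ∈ invIdeal G) : polyAct g f ∈ invIdeal G := by
  have : invIdeal G ≤ (invIdeal G).comap (polyAct g) := by
    refine Ideal.span_le.2 fun f hf => ?_
    change polyAct g f ∈ invIdeal G
    rw [hf.1 g (hHG hg)]
    exact Ideal.subset_span hf
  exact this hf

theorem sum_act_mem {n : ℕ}
    (G : Subgroup (EuclideanSpace ℝ (Fin n) ≃ₗ[ℝ] EuclideanSpace ℝ (Fin n))) [Fintype G]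
    (f : MvPolynomial (Fin n) ℝ) : ∑ w : G, polyAct w.1 f ∈ invSet G := by
  intro g hg
  rw [map_sum]
  simp_rw [← polyAct_mul']
  exact Fintype.sum_equiv (Equiv.mulLeft (⟨g, hg⟩ : G)) _ _ (fun _ => rfl)

theorem dvd_act {n : ℕ} {σ : EuclideanSpace ℝ (Fin n) ≃ₗ[ℝ] EuclideanSpace ℝ (Fin n)}
    {γ : EuclideanSpace ℝ (Fin n)} (h : ∀ x, σ x = reflectRoot γ x)
    (f : MvPolynomial (Fin n) ℝ) : toPoly γ ∣ polyAct σ f - f := by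
  have key : (Ideal.Quotient.mkₐ ℝ (Ideal.span {toPoly γ})).comp (polyAct σ) =
      Ideal.Quotient.mkₐ ℝ (Ideal.span {toPoly γ}) := by
    apply MvPolynomial.algHom_ext
    intro i
    rw [AlgHom.comp_apply, polyAct_X, ← toPoly_single, h]
    simp only [Ideal.Quotient.mkₐ_eq_mk]
    rw [Ideal.Quotient.eq, Ideal.mem_span_singleton]
    rw [reflectRoot, sub_eq_add_neg (EuclideanSpace.single i (1 : ℝ)), ← neg_smul, toPoly_add',
      add_sub_cancel_left, toPoly_smul']
    exact dvd_mul_left _ _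
  have := AlgHom.congr_fun key f
  simp only [AlgHom.comp_apply, Ideal.Quotient.mkₐ_eq_mk] at this
  rwa [Ideal.Quotient.eq, Ideal.mem_span_singleton] at this

theorem exists_demazure {n : ℕ}
    {G : Subgroup (EuclideanSpace ℝ (Fin n) ≃ₗ[ℝ] EuclideanSpace ℝ (Fin n))}
    {σ : EuclideanSpace ℝ (Fin n) ≃ₗ[ℝ] EuclideanSpace ℝ (Fin n)} (hσ : σ ∈ G)
    {γ : EuclideanSpace ℝ (Fin n)} (hγ : γ ≠ 0) (h : ∀ x, σ x = reflectRoot γ x) :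
    ∃ D : MvPolynomial (Fin n) ℝ →ₗ[invSub G] MvPolynomial (Fin n) ℝ,
      ∀ f, polyAct σ f - f = toPoly γ * D f := by
  have h0 : toPoly γ ≠ 0 := fun h' => hγ (toPoly_injective (h'.trans (map_zero (toPolyL n)).symm))
  choose q hq using fun f => dvd_act h f
  refine ⟨⟨⟨q, fun f g => ?_⟩, fun a f => ?_⟩, hq⟩
  · apply mul_left_cancel₀ h0
    rw [mul_add, ← hq, ← hq, ← hq, map_add]
    ring
  · apply mul_left_cancel₀ h0
    change toPoly γ * q (a.1 * f) = toPoly γ * (a.1 * q f)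
    rw [← hq, mul_left_comm, ← hq, map_mul, a.2 σ hσ]
    ring

theorem sep_aux {n : ℕ} (Θ : Set (EuclideanSpace ℝ (Fin n))) (hne : ∀ γ ∈ Θ, γ ≠ 0)
    [Finite (parabolic Θ)] (d : ℕ) : ∀ f : MvPolynomial (Fin n) ℝ, f.totalDegree ≤ d →
    (∀ D : MvPolynomial (Fin n) ℝ →ₗ[invSub (parabolic Θ)] MvPolynomial (Fin n) ℝ,
      MvPolynomial.constantCoeff (D f) = 0) → f ∈ invIdeal (parabolic Θ) := by
  induction d with
  | zero =>
    intro f hf hD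
    have h1 : MvPolynomial.coeff 0 f = 0 := hD LinearMap.id
    rw [MvPolynomial.totalDegree_eq_zero_iff_eq_C.1 (Nat.le_zero.1 hf), h1, map_zero]
    exact Ideal.zero_mem _
  | succ d ih =>
    intro f hf hD
    have key : ∀ w ∈ parabolic Θ, polyAct w f - f ∈ invIdeal (parabolic Θ) := by
      intro w hw
      induction hw using Subgroup.closure_induction with
      | mem σ hσ =>
        obtain ⟨γ, hγ, h⟩ := hσ
        have hσ' : σ ∈ parabolic Θ := Subgroup.subset_closure ⟨γ, hγ, h⟩
        obtain ⟨D, hDf⟩ := exists_demazure hσ' (hne γ hγ) h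
        rw [hDf]
        apply Ideal.mul_mem_left
        apply ih _ _ fun D' => hD (D' ∘ₗ D)
        by_cases hz : D f = 0
        · simp [hz]
        have h0 : toPoly γ ≠ 0 :=
          fun h' => hne γ hγ (toPoly_injective (h'.trans (map_zero (toPolyL n)).symm))
        have h1 := MvPolynomial.totalDegree_mul_of_isDomain h0 hz
        rw [← hDf, (toPoly_hom γ).totalDegree h0] at h1
        have h2 : (polyAct σ f - f).totalDegree ≤ d + 1 :=
          (MvPolynomial.totalDegree_sub _ _).trans
            (max_le ((polyAct_totalDegree σ f).trans hf) hf)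
        omega
      | one => rw [polyAct_one', sub_self]; exact Ideal.zero_mem _
      | mul x y hx hy ihx ihy =>
        have : polyAct (x * y) f - f = polyAct x (polyAct y f - f) + (polyAct x f - f) := by
          rw [polyAct_mul', map_sub]; ring
        rw [this]
        exact Ideal.add_mem _ (polyAct_invIdeal le_rfl hx ihy) ihx
      | inv x hx ihx =>
        have : polyAct x⁻¹ f - f = - polyAct x⁻¹ (polyAct x f - f) := by
          rw [map_sub, ← polyAct_mul', inv_mul_cancel, polyAct_one']; ring
        rw [this]
        exact Ideal.neg_mem_iff _ |>.2
          (polyAct_invIdeal le_rfl ((parabolic Θ).inv_mem hx) ihx)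
    have := Fintype.ofFinite (parabolic Θ)
    have h1 : ∑ w : parabolic Θ, polyAct w.1 f ∈ invIdeal (parabolic Θ) := by
      apply Ideal.subset_span
      refine ⟨sum_act_mem _ f, ?_⟩
      rw [map_sum]
      apply Finset.sum_eq_zero
      intro w _
      rw [polyAct_constantCoeff]
      exact hD LinearMap.id
    have h2 : ∑ w : parabolic Θ, (polyAct w.1 f - f) ∈ invIdeal (parabolic Θ) :=
      Ideal.sum_mem _ fun w _ => key w.1 w.2
    rw [Finset.sum_sub_distrib] at h2
    have h3 := (Ideal.sub_mem _ h1 h2)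
    rw [sub_sub_cancel, Finset.sum_const, Finset.card_univ] at h3
    have h4 := (invIdeal (parabolic Θ)).mul_mem_left
      (MvPolynomial.C ((Fintype.card (parabolic Θ) : ℝ)⁻¹)) h3
    rw [nsmul_eq_mul, ← mul_assoc] at h4
    have h5 : (MvPolynomial.C ((Fintype.card (parabolic Θ) : ℝ)⁻¹) : MvPolynomial (Fin n) ℝ) *
        (Fintype.card (parabolic Θ) : MvPolynomial (Fin n) ℝ) = 1 := by
      rw [← map_natCast (MvPolynomial.C (σ := Fin n) (R := ℝ)), ← map_mul, inv_mul_cancel₀, map_one]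
      exact_mod_cast Fintype.card_ne_zero
    rwa [h5, one_mul] at h4

/-- Constant coefficients of an operator applied to a family. -/
noncomputable def ccMap {n : ℕ} {A : Subalgebra ℝ (MvPolynomial (Fin n) ℝ)} {ι : Type*}
    (e : ι → MvPolynomial (Fin n) ℝ) :
    (MvPolynomial (Fin n) ℝ →ₗ[A] MvPolynomial (Fin n) ℝ) →ₗ[ℝ] (ι → ℝ) where
  toFun D i := MvPolynomial.constantCoeff (D (e i))
  map_add' D D' := by ext i; simp
  map_smul' c D := by ext i; simp [MvPolynomial.smul_eq_C_mul]

theorem indep_aux {n : ℕ} (Θ : Set (EuclideanSpace ℝ (Fin n))) (hne : ∀ γ ∈ Θ, γ ≠ 0)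
    [Finite (parabolic Θ)] {ι : Type*} [Fintype ι] (e : ι → MvPolynomial (Fin n) ℝ)
    (he : LinearIndependent ℝ fun i => Ideal.Quotient.mk (invIdeal (parabolic Θ)) (e i)) :
    LinearIndependent (invSub (parabolic Θ)) e := by
  classical
  let F : ι → (MvPolynomial (Fin n) ℝ →ₗ[invSub (parabolic Θ)] MvPolynomial (Fin n) ℝ) → ℝ :=
    fun i D => MvPolynomial.constantCoeff (D (e i))
  have hF : LinearIndependent ℝ F := by
    rw [Fintype.linearIndependent_iff] at he ⊢
    intro c hc
    apply he c
    have h : (∑ i, c i • e i) ∈ invIdeal (parabolic Θ) := by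
      apply sep_aux Θ hne _ _ le_rfl
      intro D
      have := congrFun hc D
      simp only [F, Finset.sum_apply, Pi.smul_apply, Pi.zero_apply, smul_eq_mul] at this
      rw [map_sum, map_sum, ← this]
      refine Finset.sum_congr rfl fun i _ => ?_
      rw [LinearMap.map_smul_of_tower, MvPolynomial.smul_eq_C_mul, map_mul,
        MvPolynomial.constantCoeff_C]
    rw [← Ideal.Quotient.eq_zero_iff_mem] at h
    rw [← h, map_sum]
    rfl
  rw [← span_flip_eq_top_iff_linearIndependent] at hF
  have hr : ∀ v : ι → ℝ, ∃ D, ccMap (A := invSub (parabolic Θ)) e D = v := by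
    intro v
    have h1 : Submodule.span ℝ (Set.range fun D i => F i D) ≤
        LinearMap.range (ccMap (A := invSub (parabolic Θ)) e) := by
      refine Submodule.span_le.2 ?_
      rintro _ ⟨D, rfl⟩
      exact ⟨D, rfl⟩
    exact h1 (hF ▸ Submodule.mem_top : v ∈ _)
  choose D hD using fun j : ι => hr (Pi.single j 1)
  let M : Matrix ι ι (MvPolynomial (Fin n) ℝ) := fun j i => D j (e i)
  have hM : M.map MvPolynomial.constantCoeff = (1 : Matrix ι ι ℝ) := by
    ext j i
    have := congrFun (hD j) i
    rw [Matrix.one_apply, Matrix.map_apply]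
    change MvPolynomial.constantCoeff (D j (e i)) = _ at this
    rw [Pi.single_apply] at this
    simp only [M, this, eq_comm]
  have hdet : M.det ≠ 0 := by
    intro h
    have h2 := RingHom.map_det (MvPolynomial.constantCoeff (σ := Fin n) (R := ℝ)) M
    rw [h, RingHom.mapMatrix_apply, hM, Matrix.det_one, map_zero] at h2
    exact zero_ne_one h2
  rw [Fintype.linearIndependent_iff]
  intro g hg i
  have h3 : M.mulVec (fun i => (g i : MvPolynomial (Fin n) ℝ)) = 0 := by
    ext1 j
    have := congrArg (D j) hg
    rw [map_sum, map_zero] at this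
    rw [Pi.zero_apply, ← this]
    refine Finset.sum_congr rfl fun i _ => ?_
    rw [map_smul, mul_comm]
    rfl
  exact Subtype.ext (congrFun (Matrix.eq_zero_of_mulVec_eq_zero hdet h3) i)

theorem homComp_mem {n : ℕ}
    {G : Subgroup (EuclideanSpace ℝ (Fin n) ≃ₗ[ℝ] EuclideanSpace ℝ (Fin n))}
    {f : MvPolynomial (Fin n) ℝ} (hf : f ∈ invSet G) (d : ℕ) :
    MvPolynomial.homogeneousComponent d f ∈ invSet G := by
  intro w hw
  rw [polyAct_homComp, hf w hw]

theorem span_aux {n : ℕ}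
    (G : Subgroup (EuclideanSpace ℝ (Fin n) ≃ₗ[ℝ] EuclideanSpace ℝ (Fin n)))
    {ι : Type*} (e : ι → MvPolynomial (Fin n) ℝ) (deg : ι → ℕ)
    (hdeg : ∀ i, (e i).IsHomogeneous (deg i))
    (he : Submodule.span ℝ (Set.range fun i => Ideal.Quotient.mk (invIdeal G) (e i)) = ⊤) :
    Submodule.span (invSub G) (Set.range e) = ⊤ := by
  set N := Submodule.span (invSub G) (Set.range e) with hN
  have hmem : ∀ i, e i ∈ N := fun i => Submodule.subset_span ⟨i, rfl⟩
  have key : ∀ d, ∀ f, MvPolynomial.homogeneousComponent d f ∈ N := by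
    intro d
    induction d using Nat.strong_induction_on with
    | _ d ih =>
    have hI' : ∀ f ∈ invIdeal G, ∀ a, MvPolynomial.homogeneousComponent d (a * f) ∈ N := by
      intro f hf
      induction hf using Submodule.span_induction with
      | zero => intro a; rw [mul_zero, map_zero]; exact N.zero_mem
      | add x y _ _ hx hy => intro a; rw [mul_add, map_add]; exact N.add_mem (hx a) (hy a)
      | smul a' x _ hx => intro a; rw [smul_eq_mul, ← mul_assoc]; exact hx _
      | mem h hh =>
        intro a
        rw [← MvPolynomial.sum_homogeneousComponent h, Finset.mul_sum, map_sum]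
        refine N.sum_mem fun k _ => ?_
        rw [← MvPolynomial.sum_homogeneousComponent a, Finset.sum_mul, map_sum]
        refine N.sum_mem fun j _ => ?_
        rw [MvPolynomial.homogeneousComponent_of_mem
          ((MvPolynomial.homogeneousComponent_isHomogeneous j a).mul
            (MvPolynomial.homogeneousComponent_isHomogeneous k h))]
        split_ifs with hd
        · rcases Nat.eq_zero_or_pos k with rfl | hk
          · have h0 : MvPolynomial.coeff 0 h = 0 := hh.2
            rw [MvPolynomial.homogeneousComponent_zero, h0, map_zero, mul_zero]
            exact N.zero_mem
          · rw [mul_comm]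
            exact N.smul_mem (⟨_, homComp_mem hh.1 k⟩ : invSub G) (ih j (by omega) a)
        · exact N.zero_mem
    have hI : ∀ f ∈ invIdeal G, MvPolynomial.homogeneousComponent d f ∈ N := by
      intro f hf
      simpa using hI' f hf 1
    intro f
    obtain ⟨g, hg, hfg⟩ : ∃ g ∈ Submodule.span ℝ (Set.range e), f - g ∈ invIdeal G := by
      have h1 : Ideal.Quotient.mk (invIdeal G) f ∈
          (Submodule.span ℝ (Set.range e)).map
            (Ideal.Quotient.mkₐ ℝ (invIdeal G)).toLinearMap := by
        rw [Submodule.map_span, ← Set.range_comp]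
        exact (he ▸ Submodule.mem_top : _ ∈ Submodule.span ℝ _)
      obtain ⟨g, hg, h2⟩ := h1
      exact ⟨g, hg, Ideal.Quotient.eq.1 h2.symm⟩
    rw [← sub_add_cancel f g, map_add]
    refine N.add_mem (hI _ hfg) ?_
    clear hfg
    induction hg using Submodule.span_induction with
    | zero => rw [map_zero]; exact N.zero_mem
    | add x y _ _ hx hy => rw [map_add]; exact N.add_mem hx hy
    | mem h hh =>
      obtain ⟨i, rfl⟩ := hh
      rw [MvPolynomial.homogeneousComponent_of_mem (hdeg i)]
      split_ifs
      · exact hmem i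
      · exact N.zero_mem
    | smul a x _ hx => rw [map_smul]; exact N.smul_of_tower_mem a hx
  rw [eq_top_iff]
  intro f _
  rw [← MvPolynomial.sum_homogeneousComponent f]
  exact N.sum_mem fun i _ => key i f

theorem exists_basis {n : ℕ} (Θ : Set (EuclideanSpace ℝ (Fin n))) (hne : ∀ γ ∈ Θ, γ ≠ 0)
    [Finite (parabolic Θ)] :
    Nonempty (Module.Basis (Fin (Nat.card (parabolic Θ))) (invSub (parabolic Θ))
      (MvPolynomial (Fin n) ℝ)) := by
  obtain ⟨κ, a, ha, hspan, hli⟩ := exists_linearIndependent' (K := ℝ)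
    (fun m : Fin n →₀ ℕ => Ideal.Quotient.mk (invIdeal (parabolic Θ)) (MvPolynomial.monomial m 1))
  have htop : Submodule.span ℝ (Set.range (fun m : Fin n →₀ ℕ =>
      Ideal.Quotient.mk (invIdeal (parabolic Θ)) (MvPolynomial.monomial m (1 : ℝ)))) = ⊤ := by
    have h1 := (MvPolynomial.basisMonomials (Fin n) ℝ).span_eq
    have h2 := congrArg (Submodule.map (Ideal.Quotient.mkₐ ℝ (invIdeal (parabolic Θ))).toLinearMap) h1
    rw [Submodule.map_span, ← Set.range_comp, Submodule.map_top, LinearMap.range_eq_top.2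
      (Ideal.Quotient.mkₐ_surjective ℝ _)] at h2
    rw [← h2]
    congr 2
  have hs := span_aux (parabolic Θ) (fun k => MvPolynomial.monomial (a k) (1 : ℝ))
    (fun k => (a k).degree) (fun k => MvPolynomial.isHomogeneous_monomial _ rfl)
    (hspan.trans htop)
  have hl : LinearIndependent (invSub (parabolic Θ))
      (fun k => MvPolynomial.monomial (a k) (1 : ℝ)) := by
    rw [linearIndependent_iff_finset_linearIndependent]
    intro s
    exact indep_aux Θ hne _ (hli.comp (Subtype.val : s → κ) Subtype.val_injective)
  let b := Module.Basis.mk hl hs.ge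
  have hcard : Nat.card κ = Nat.card (parabolic Θ) := by
    rw [finrank_invSub, Module.finrank_eq_nat_card_basis b]
  have hκ : Finite κ := Nat.finite_of_card_ne_zero (by
    rw [hcard]
    exact Nat.card_pos.ne')
  exact ⟨b.reindex (Finite.equivFinOfCardEq hcard)⟩

theorem relInv_mk {n : ℕ}
    {G H : Subgroup (EuclideanSpace ℝ (Fin n) ≃ₗ[ℝ] EuclideanSpace ℝ (Fin n))} (hHG : H ≤ G)
    {f : MvPolynomial (Fin n) ℝ} (hf : f ∈ invSet H) :
    relInv H (invIdeal G) (Ideal.Quotient.mk _ f) := by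
  intro w hw F hF
  rw [Ideal.Quotient.eq] at hF ⊢
  have := polyAct_invIdeal hHG hw hF
  rwa [map_sub, hf w hw] at this

theorem exists_inv_lift {n : ℕ}
    {H : Subgroup (EuclideanSpace ℝ (Fin n) ≃ₗ[ℝ] EuclideanSpace ℝ (Fin n))} [Finite H]
    (I : Ideal (MvPolynomial (Fin n) ℝ)) {x : MvPolynomial (Fin n) ℝ ⧸ I} (hx : relInv H I x) :
    ∃ f ∈ invSet H, Ideal.Quotient.mk I f = x := by
  have := Fintype.ofFinite H
  obtain ⟨F, rfl⟩ := Ideal.Quotient.mk_surjective x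
  refine ⟨(Fintype.card H : ℝ)⁻¹ • ∑ w : H, polyAct w.1 F,
    (invSub H).smul_mem (sum_act_mem H F) _, ?_⟩
  rw [← Ideal.Quotient.mkₐ_eq_mk ℝ, map_smul, map_sum]
  have h : ∀ w : H, Ideal.Quotient.mkₐ ℝ I (polyAct w.1 F) = Ideal.Quotient.mkₐ ℝ I F :=
    fun w => hx w.1 w.2 F rfl
  simp_rw [h]
  rw [Finset.sum_const, Finset.card_univ, ← Nat.cast_smul_eq_nsmul ℝ, smul_smul,
    inv_mul_cancel₀, one_smul]
  exact_mod_cast Fintype.card_ne_zero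

theorem repr_mem {n : ℕ}
    {G H : Subgroup (EuclideanSpace ℝ (Fin n) ≃ₗ[ℝ] EuclideanSpace ℝ (Fin n))} (hHG : H ≤ G)
    {ι : Type*} (b : Module.Basis ι (invSub H) (MvPolynomial (Fin n) ℝ))
    {F : MvPolynomial (Fin n) ℝ} (hF : F ∈ invIdeal G) (i : ι) :
    (b.repr F i : MvPolynomial (Fin n) ℝ) ∈ invIdeal G := by
  suffices h : ∀ a, (b.repr (a * F) i : MvPolynomial (Fin n) ℝ) ∈ invIdeal G by
    simpa using h 1
  induction hF using Submodule.span_induction with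
  | zero => intro a; simp
  | add x y _ _ hx hy =>
    intro a
    rw [mul_add, map_add, Finsupp.add_apply]
    exact Ideal.add_mem _ (hx a) (hy a)
  | smul a' x _ hx => intro a; rw [smul_eq_mul, ← mul_assoc]; exact hx _
  | mem h hh =>
    intro a
    let h' : invSub H := ⟨h, fun w hw => hh.1 w (hHG hw)⟩
    have : a * h = h' • a := mul_comm _ _
    rw [this, map_smul, Finsupp.smul_apply]
    exact Ideal.mul_mem_right _ _ (Ideal.subset_span hh)

theorem finite_W {n : ℕ} (R : RootData n) : Finite R.W := by
  have hΦ : Finite R.Φ := R.finite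
  have key : ∀ w ∈ R.W, (∀ γ ∈ R.Φ, w γ ∈ R.Φ) ∧
      (∀ x, (∀ γ ∈ R.Φ, ⟪x, γ⟫ = 0) → w x = x) := by
    intro w hw
    induction hw using Subgroup.closure_induction with
    | mem σ hσ =>
      obtain ⟨γ, hγ, h⟩ := hσ
      refine ⟨fun β hβ => h β ▸ R.reflect_mem γ hγ β hβ, fun x hx => ?_⟩
      rw [h, reflectRoot, hx γ hγ]
      simp
    | one => exact ⟨fun _ h => h, fun _ _ => rfl⟩
    | mul x y _ _ hx hy =>
      refine ⟨fun γ hγ => hx.1 _ (hy.1 γ hγ), fun v hv => ?_⟩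
      change x (y v) = v
      rw [hy.2 v hv, hx.2 v hv]
    | inv x _ hx =>
      refine ⟨fun γ hγ => ?_, fun v hv => ?_⟩
      · let φ : R.Φ → R.Φ := fun γ => ⟨x γ, hx.1 γ γ.2⟩
        have hφ : Function.Injective φ := fun a b h =>
          Subtype.ext (x.injective (congrArg Subtype.val h))
        obtain ⟨β, hβ⟩ := Finite.injective_iff_surjective.1 hφ ⟨γ, hγ⟩
        have h1 : x β = γ := congrArg Subtype.val hβ
        have h2 : x⁻¹ γ = β := by
          rw [← h1]
          exact x.symm_apply_apply _
        rw [h2]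
        exact β.2
      · conv_lhs => rw [← hx.2 v hv]
        exact x.symm_apply_apply v
  refine Finite.of_injective (fun (w : R.W) (γ : R.Φ) => (⟨w.1 γ, (key w.1 w.2).1 γ γ.2⟩ : R.Φ)) ?_
  intro w₁ w₂ h
  apply Subtype.ext
  apply LinearEquiv.toLinearMap_injective
  rw [← LinearMap.eqLocus_eq_top, eq_top_iff,
    ← Submodule.sup_orthogonal_of_hasOrthogonalProjection (K := Submodule.span ℝ R.Φ)]
  refine sup_le (Submodule.span_le.2 fun γ hγ => ?_) fun x hx => ?_
  · exact congrArg Subtype.val (congrFun h ⟨γ, hγ⟩)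
  · have hx' : ∀ γ ∈ R.Φ, ⟪x, γ⟫ = 0 := fun γ hγ =>
      (Submodule.mem_orthogonal' _ _).1 hx γ (Submodule.subset_span hγ)
    exact ((key w₁.1 w₁.2).2 x hx').trans ((key w₂.1 w₂.2).2 x hx').symm

/-- the natural map ι : S_W → S_{W_Θ} (induced by the identity of S) is
well defined and surjective, its kernel is the ideal (S_W^{W_Θ})⁺·S_W generated by the
positive-degree W_Θ-invariant elements of S_W, and S_W is a free module of rank |W_Θ|
over the relative coinvariant ring S_W^{W_Θ}. -/
theorem coinvariants_leray_hirsch {n : ℕ} (R : RootData n)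
    (Θ : Set (EuclideanSpace ℝ (Fin n))) (hΘ : Θ ⊆ R.Δ) :
    -- ι is well defined on S_W (i.e. I ⊆ I_Θ), automatically surjective
    (∀ F F' : MvPolynomial (Fin n) ℝ,
      Ideal.Quotient.mk (invIdeal R.W) F = Ideal.Quotient.mk (invIdeal R.W) F' →
      Ideal.Quotient.mk (invIdeal (parabolic Θ)) F =
        Ideal.Quotient.mk (invIdeal (parabolic Θ)) F') ∧
    -- the kernel of ι is (S_W^{W_Θ})⁺ · S_W
    (∀ F : MvPolynomial (Fin n) ℝ,
      Ideal.Quotient.mk (invIdeal (parabolic Θ)) F = 0 ↔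
        Ideal.Quotient.mk (invIdeal R.W) F ∈
          Ideal.span (Ideal.Quotient.mk (invIdeal R.W) ''
            {f | f ∈ invSet (parabolic Θ) ∧ MvPolynomial.constantCoeff f = 0})) ∧
    -- S_W is a free S_W^{W_Θ}-module of rank |W_Θ|
    ∃ bas : Fin (Nat.card (parabolic Θ)) → MvPolynomial (Fin n) ℝ ⧸ invIdeal R.W,
      ∀ x : MvPolynomial (Fin n) ℝ ⧸ invIdeal R.W,
        ∃! c : Fin (Nat.card (parabolic Θ)) → MvPolynomial (Fin n) ℝ ⧸ invIdeal R.W,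
          (∀ i, relInv (parabolic Θ) (invIdeal R.W) (c i)) ∧
            x = ∑ i, c i * bas i := by
  have hle : parabolic Θ ≤ R.W := Subgroup.closure_mono (by
    rintro σ ⟨γ, hγ, h⟩
    exact ⟨γ, R.pos_sub (R.Δ_sub (hΘ hγ)), h⟩)
  have hne : ∀ γ ∈ Θ, γ ≠ 0 := fun γ hγ => R.nonzero γ (R.pos_sub (R.Δ_sub (hΘ hγ)))
  have hfinW : Finite R.W := finite_W R
  have hfin : Finite (parabolic Θ) :=
    Finite.of_injective (Subgroup.inclusion hle) (Subgroup.inclusion_injective hle)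
  have hII : invIdeal R.W ≤ invIdeal (parabolic Θ) :=
    Ideal.span_mono fun f hf => ⟨fun w hw => hf.1 w (hle hw), hf.2⟩
  refine ⟨fun F F' h => ?_, fun F => ?_, ?_⟩
  · rw [Ideal.Quotient.eq] at h ⊢
    exact hII h
  · rw [← Ideal.map_span, ← Ideal.mem_comap,
      Ideal.comap_map_of_surjective _ Ideal.Quotient.mk_surjective, Ideal.Quotient.eq_zero_iff_mem,
      ← RingHom.ker_eq_comap_bot, Ideal.mk_ker]
    change _ ↔ F ∈ invIdeal (parabolic Θ) ⊔ invIdeal R.W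
    rw [sup_eq_left.2 hII]
  · obtain ⟨b⟩ := exists_basis Θ hne
    refine ⟨fun i => Ideal.Quotient.mk _ (b i), fun x => ?_⟩
    obtain ⟨F, rfl⟩ := Ideal.Quotient.mk_surjective x
    refine ⟨fun i => Ideal.Quotient.mk _ (b.repr F i : MvPolynomial (Fin n) ℝ), ⟨?_, ?_⟩, ?_⟩
    · intro i
      exact relInv_mk hle (b.repr F i).2
    · conv_lhs => rw [← b.sum_repr F]
      rw [map_sum]
      refine Finset.sum_congr rfl fun i _ => ?_
      rw [← map_mul]
      rfl
    · rintro c ⟨hc, hx⟩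
      choose f hf hcf using fun i => exists_inv_lift _ (hc i)
      have h1 : ∑ i, (⟨f i, hf i⟩ : invSub (parabolic Θ)) • b i - F ∈ invIdeal R.W := by
        rw [← Ideal.Quotient.eq, hx, map_sum]
        refine Finset.sum_congr rfl fun i _ => ?_
        rw [← hcf, ← map_mul]
        rfl
      funext i
      have h2 := repr_mem hle b h1 i
      rw [map_sub, Finsupp.sub_apply, b.repr_sum_self] at h2
      rw [← hcf, Ideal.Quotient.eq]
      exact h2
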